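/- Suppose the norm on E is strictly convex (the boundary of the unit ball contains no line segment). Let n ≥ 3 be an odd integer and let v_1, …, v_n be vectors in E with ‖v_i‖ = 1 for every i, and suppose there is a nonzero linear functional u : E → ℝ with u(v_i) ≥ 0 for every i. Then ‖v_1 + ⋯ + v_n‖ = 1 if and only if there exist a vector w with ‖w‖ = 1 and two disjoint subsets S, T of {1,…,n}, each of cardinality (n-1)/2, such that v_i = w for all i ∈ S and v_i = -w for all i ∈ T. -/

import Mathlib

section UnitVectorsInHalfplane

variable {E : Type*} [NormedAddCommGroup E] [NormedSpace ℝ E]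

/-- In a plane, two unit vectors killed by the same nonzero functional agree up to sign. -/
lemma eq_or_eq_neg_of_map_eq_zero (hdim : Module.finrank ℝ E = 2) {u : E →ₗ[ℝ] ℝ} (hu : u ≠ 0)
    {x y : E} (hx : ‖x‖ = 1) (hy : ‖y‖ = 1) (hux : u x = 0) (huy : u y = 0) :
    y = x ∨ y = -x := by
  have : FiniteDimensional ℝ E := .of_finrank_pos (by omega)
  have hker : Module.finrank ℝ u.ker = 1 := by
    have h := Module.Dual.finrank_ker_add_one_of_ne_zero hu
    omega
  have hx0 : (⟨x, hux⟩ : u.ker) ≠ 0 := by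
    intro h
    have : x = 0 := congrArg Subtype.val h
    simp [this] at hx
  obtain ⟨t, ht⟩ := (finrank_eq_one_iff_of_nonzero' _ hx0).1 hker ⟨y, huy⟩
  have hty : t • x = y := congrArg Subtype.val ht
  have habs : |t| = 1 := by
    rw [← hty, norm_smul, hx, mul_one] at hy
    exact hy
  rcases eq_or_eq_neg_of_abs_eq habs with rfl | rfl
  · left; simpa using hty.symm
  · right; simpa using hty.symm

/-- A nonzero functional on a plane can be completed to a coordinate system. -/
lemma exists_complementary_functional (hdim : Module.finrank ℝ E = 2) {u : E →ₗ[ℝ] ℝ}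
    (hu : u ≠ 0) : ∃ c : E →ₗ[ℝ] ℝ, ∀ x, c x = 0 → u x = 0 → x = 0 := by
  have : FiniteDimensional ℝ E := .of_finrank_pos (by omega)
  have hker : Module.finrank ℝ u.ker = 1 := by
    have h := Module.Dual.finrank_ker_add_one_of_ne_zero hu
    omega
  obtain ⟨w, hw, hspan⟩ := finrank_eq_one_iff'.1 hker
  have hw' : (w : E) ≠ 0 := by simpa using hw
  obtain ⟨c, -, hc⟩ := exists_dual_vector ℝ (w : E) (norm_ne_zero_iff.2 hw')
  refine ⟨c.toLinearMap, fun x hcx hux ↦ ?_⟩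
  obtain ⟨t, ht⟩ := hspan ⟨x, hux⟩
  have htx : t • (w : E) = x := congrArg Subtype.val ht
  rw [← htx] at hcx ⊢
  have : t * ‖(w : E)‖ = 0 := by simpa [hc] using hcx
  rcases mul_eq_zero.1 this with h | h
  · simp [h]
  · exact absurd (norm_eq_zero.1 h) hw'

/-- A functional supporting the unit ball at `m` is nonnegative on `a + b` when the unit vector `m`
lies in the cone spanned by the unit vectors `a`, `b`; it vanishes only if `a = -b`. -/
lemma add_nonneg_of_mem_cone [StrictConvexSpace ℝ E] {f : E →ₗ[ℝ] ℝ} (hf : ∀ x, |f x| ≤ ‖x‖)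
    {a b m : E} (ha : ‖a‖ = 1) (hb : ‖b‖ = 1) (hm : ‖m‖ = 1) (hfm : f m = 1)
    {p q D : ℝ} (hp : 0 ≤ p) (hq : 0 ≤ q) (hD : 0 < D) (h : p • a + q • b = D • m) :
    0 ≤ f a + f b ∧ (f a + f b = 0 → a = -b) := by
  wlog hab : f a ≤ f b generalizing a b p q
  · obtain ⟨h₁, h₂⟩ := this hb ha hq hp (by rw [add_comm, h]) (le_of_not_ge hab)
    refine ⟨by linarith, fun h₀ ↦ ?_⟩
    rw [h₂ (by linarith), neg_neg]
  have hval : p * f a + q * f b = D := by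
    have := congrArg f h
    simpa [hfm] using this
  have hqle : q ≤ D + p := by
    have hqb : q • b = D • m - p • a := by rw [← h]; abel
    have := norm_sub_le (D • m) (p • a)
    rwa [← hqb, norm_smul, norm_smul, norm_smul, ha, hb, hm, Real.norm_of_nonneg hp,
      Real.norm_of_nonneg hq, Real.norm_of_nonneg hD.le, mul_one, mul_one, mul_one] at this
  have hfa : |f a| ≤ 1 := ha ▸ hf a
  have hfb : |f b| ≤ 1 := hb ▸ hf b
  rw [abs_le] at hfa hfb
  have hfb0 : 0 < f b := by
    by_contra! hneg
    nlinarith [mul_nonneg hp (neg_nonneg.2 (hab.trans hneg)), mul_nonneg hq (neg_nonneg.2 hneg)]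
  have key : D * (1 - f b) ≤ p * (f a + f b) := by
    nlinarith [mul_le_mul_of_nonneg_right hqle hfb0.le]
  refine ⟨?_, fun h₀ ↦ ?_⟩
  · by_contra! hneg
    nlinarith [mul_nonneg hp (neg_nonneg.2 hneg.le), mul_pos hD (show 0 < 1 - f b by linarith)]
  · rw [h₀, mul_zero] at key
    have hb1 : f b = 1 := by nlinarith
    have hnorm : ‖b + -a‖ = ‖b‖ + ‖-a‖ := by
      refine le_antisymm (norm_add_le _ _) ?_
      have := (le_abs_self _).trans (hf (b + -a))
      rw [map_add, map_neg] at this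
      rw [norm_neg, ha, hb]
      linarith
    have := (sameRay_iff_norm_add.2 hnorm).eq_of_norm_eq (by rw [norm_neg, ha, hb])
    rw [this, neg_neg]

/-- On the halfplane `0 ≤ y`, the quantity `x / (|x| + y)` is monotone in the slope. -/
lemma mul_le_mul_of_div_abs_add_le {x y x' y' : ℝ} (hy : 0 ≤ y) (hy' : 0 ≤ y')
    (h : 0 < |x| + y) (h' : 0 < |x'| + y') (hle : x / (|x| + y) ≤ x' / (|x'| + y')) :
    x * y' ≤ x' * y := by
  rw [div_le_div_iff₀ h h'] at hle
  rcases abs_cases x with ⟨e, hx⟩ | ⟨e, hx⟩ <;> rcases abs_cases x' with ⟨e', hx'⟩ | ⟨e', hx'⟩ <;>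
    rw [e] at hle h <;> rw [e'] at hle h' <;> nlinarith

/-- A functional supporting the unit ball at `m` is nonnegative on `a + b` when the unit vectors
`a`, `m`, `b` of the halfplane `0 ≤ u` are ordered by angle; it vanishes only if `a = -b`. -/
lemma add_nonneg_of_div_abs_add_le [StrictConvexSpace ℝ E] {f c u : E →ₗ[ℝ] ℝ}
    (hf : ∀ x, |f x| ≤ ‖x‖) (hcu : ∀ x, c x = 0 → u x = 0 → x = 0)
    {a b m : E} (ha : ‖a‖ = 1) (hb : ‖b‖ = 1) (hm : ‖m‖ = 1) (hfm : f m = 1)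
    (hua : 0 ≤ u a) (hub : 0 ≤ u b) (hum : 0 ≤ u m)
    (ham : c a / (|c a| + u a) ≤ c m / (|c m| + u m))
    (hmb : c m / (|c m| + u m) ≤ c b / (|c b| + u b)) :
    0 ≤ f a + f b ∧ (f a + f b = 0 → a = -b) := by
  have hext : ∀ x y, c x = c y → u x = u y → x = y := fun x y h₁ h₂ ↦
    sub_eq_zero.1 (hcu _ (by rw [map_sub, h₁, sub_self]) (by rw [map_sub, h₂, sub_self]))
  have hpos : ∀ x, ‖x‖ = 1 → 0 ≤ u x → 0 < |c x| + u x := by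
    intro x hx hux
    by_contra! hle
    have h₁ := abs_nonneg (c x)
    have hx0 := hcu x (abs_eq_zero.1 (by linarith)) (by linarith)
    simp [hx0] at hx
  have hA := hpos a ha hua
  have hB := hpos b hb hub
  have hM := hpos m hm hum
  have h₁ := mul_le_mul_of_div_abs_add_le hua hum hA hM ham
  have h₂ := mul_le_mul_of_div_abs_add_le hum hub hM hB hmb
  have h₃ := mul_le_mul_of_div_abs_add_le hua hub hA hB (ham.trans hmb)
  rcases h₃.lt_or_eq with hlt | heq
  · refine add_nonneg_of_mem_cone hf ha hb hm hfm (sub_nonneg.2 h₂) (sub_nonneg.2 h₁)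
      (sub_pos.2 hlt) (hext _ _ ?_ ?_) <;> simp only [map_add, map_smul, smul_eq_mul] <;> ring
  · have hpar : ∀ x y : E, ‖x‖ = 1 → ‖y‖ = 1 → 0 ≤ u x → 0 ≤ u y → c x * u y = c y * u x →
        x = y ∨ x = -y := by
      intro x y hx hy hux huy hxy
      have hsmul : u y • x = u x • y := hext _ _
        (by simp only [map_smul, smul_eq_mul]; linarith)
        (by simp only [map_smul, smul_eq_mul]; ring)
      have hu : u y = u x := by
        have := congrArg norm hsmul
        rwa [norm_smul, norm_smul, hx, hy, Real.norm_of_nonneg hux, Real.norm_of_nonneg huy,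
          mul_one, mul_one] at this
      rcases hux.lt_or_eq with hux' | hux'
      · rw [hu] at hsmul
        exact Or.inl (smul_right_injective E hux'.ne' hsmul)
      · have hsmul' : c y • x = c x • y := hext _ _
          (by simp only [map_smul, smul_eq_mul]; ring)
          (by simp only [map_smul, smul_eq_mul]; rw [hu, ← hux']; ring)
        have hc : |c y| = |c x| := by
          have := congrArg norm hsmul'
          rwa [norm_smul, norm_smul, hx, hy, mul_one, mul_one] at this
        rcases abs_eq_abs.1 hc with h | h
        · exact Or.inl (hext _ _ h.symm hu.symm)
        · refine Or.inr (hext _ _ ?_ ?_)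
          · rw [map_neg, h, neg_neg]
          · rw [map_neg, hu, ← hux', neg_zero]
    rcases hpar a b ha hb hua hub heq with rfl | hab
    · have hkey := le_antisymm ham hmb
      rcases hpar a m ha hm hua hum (le_antisymm h₁ h₂) with rfl | ham'
      · rw [hfm]
        norm_num
      · exfalso
        have hu0 : u a = -u m := by rw [ham', map_neg]
        have hum0 : u m = 0 := by linarith
        have hc0 : c a = -c m := by rw [ham', map_neg]
        rw [hu0, hc0, hum0, abs_neg, neg_zero] at hkey
        rw [hum0] at hM
        rw [div_left_inj' hM.ne'] at hkey
        have : c m = 0 := by linarith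
        simp [this] at hM
    · exact ⟨by simp [hab], fun _ ↦ hab⟩

/-- If an odd number of unit vectors of a halfplane, ordered by angle, have a sum of norm one, then
all but the middle one lie on the boundary line of the halfplane, and they sum to zero. -/
lemma map_eq_zero_of_norm_sum_eq_one [StrictConvexSpace ℝ E] {c u : E →ₗ[ℝ] ℝ}
    (hcu : ∀ x, c x = 0 → u x = 0 → x = 0) {n : ℕ} {v : Fin n → E} (hv : ∀ i, ‖v i‖ = 1)
    (hpos : ∀ i, 0 ≤ u (v i)) (hmono : Monotone fun i ↦ c (v i) / (|c (v i)| + u (v i)))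
    {j : Fin n} (hj : j.rev = j) (hsum : ‖∑ i, v i‖ = 1) :
    (∀ i ≠ j, u (v i) = 0) ∧ ∑ i ∈ Finset.univ.erase j, v i = 0 := by
  have hj0 : ‖v j‖ ≠ 0 := by simp [hv]
  obtain ⟨g, hg, hgj⟩ := exists_dual_vector ℝ (v j) hj0
  have hf : ∀ x, |g.toLinearMap x| ≤ ‖x‖ := fun x ↦ by
    simpa [hg] using g.le_opNorm x
  have hfj : g.toLinearMap (v j) = 1 := by simpa [hv] using hgj
  generalize g.toLinearMap = f at hf hfj
  have hpair : ∀ i, 0 ≤ f (v i) + f (v i.rev) ∧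
      (f (v i) + f (v i.rev) = 0 → v i = -v i.rev) := by
    intro i
    rcases le_total i j with hij | hij
    · have hji : j ≤ i.rev := by rw [← hj]; exact Fin.rev_le_rev.2 hij
      exact add_nonneg_of_div_abs_add_le hf hcu (hv _) (hv _) (hv j) hfj (hpos _) (hpos _)
        (hpos _) (hmono hij) (hmono hji)
    · have hji : i.rev ≤ j := by rw [← hj]; exact Fin.rev_le_rev.2 hij
      obtain ⟨h₁, h₂⟩ := add_nonneg_of_div_abs_add_le hf hcu (hv _) (hv _) (hv j) hfj (hpos _)
        (hpos _) (hpos _) (hmono hji) (hmono hij)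
      exact ⟨by linarith, fun h ↦ by rw [h₂ (by linarith), neg_neg]⟩
  have hrev : ∀ w : Fin n → ℝ, ∑ i : Fin n, w i.rev = ∑ i, w i := fun w ↦
    Equiv.sum_comp Fin.revPerm w
  have htwo : ∑ i, (f (v i) + f (v i.rev)) = 2 * f (∑ i, v i) := by
    rw [Finset.sum_add_distrib, hrev fun i ↦ f (v i), map_sum]
    ring
  have hle : f (∑ i, v i) ≤ 1 := hsum ▸ (le_abs_self _).trans (hf _)
  have hsplit := Finset.add_sum_erase Finset.univ (fun i ↦ f (v i) + f (v i.rev))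
    (Finset.mem_univ j)
  simp only [hj, hfj] at hsplit
  have hzero : ∑ i ∈ Finset.univ.erase j, (f (v i) + f (v i.rev)) = 0 :=
    le_antisymm (by linarith) (Finset.sum_nonneg fun i _ ↦ (hpair i).1)
  have hanti : ∀ i ≠ j, v i = -v i.rev := fun i hi ↦ (hpair i).2
    ((Finset.sum_eq_zero_iff_of_nonneg fun i _ ↦ (hpair i).1).1 hzero i
      (Finset.mem_erase.2 ⟨hi, Finset.mem_univ i⟩))
  refine ⟨fun i hi ↦ ?_, ?_⟩
  · have := congrArg u (hanti i hi)
    rw [map_neg] at this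
    linarith [hpos i, hpos i.rev]
  · refine Finset.sum_involution (fun i _ ↦ i.rev) (fun i hi ↦ ?_) (fun i hi hne h ↦ ?_)
      (fun i hi ↦ ?_) (fun i _ ↦ Fin.rev_rev i)
    · rw [hanti i (Finset.ne_of_mem_erase hi), neg_add_cancel]
    · have := hanti i (Finset.ne_of_mem_erase hi)
      rw [h] at this
      refine hne ((smul_eq_zero_iff_right (two_ne_zero (α := ℝ))).1 ?_)
      rw [two_smul, ← eq_neg_iff_add_eq_zero]
      exact this
    · refine Finset.mem_erase.2 ⟨fun h ↦ Finset.ne_of_mem_erase hi ?_, Finset.mem_univ _⟩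
      rw [← Fin.rev_rev i, h, hj]

end UnitVectorsInHalfplane

/-- Remark 1: in a strictly convex normed plane, under the hypotheses of the
halfplane theorem, equality `‖v 1 + ⋯ + v n‖ = 1` holds iff `(n-1)/2` of the
vectors equal some unit vector `w` and another `(n-1)/2` equal `-w`. -/
theorem norm_sum_eq_one_iff_of_strictConvex
    {E : Type*} [NormedAddCommGroup E] [NormedSpace ℝ E] [StrictConvexSpace ℝ E]
    (hdim : Module.finrank ℝ E = 2)
    {n : ℕ} (hn : 3 ≤ n) (hodd : Odd n)
    (v : Fin n → E) (hv : ∀ i, ‖v i‖ = 1)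
    (u : E →ₗ[ℝ] ℝ) (hu : u ≠ 0) (hpos : ∀ i, 0 ≤ u (v i)) :
    ‖∑ i, v i‖ = 1 ↔
      ∃ (w : E) (S T : Finset (Fin n)), ‖w‖ = 1 ∧ Disjoint S T ∧
        S.card = (n - 1) / 2 ∧ T.card = (n - 1) / 2 ∧
        (∀ i ∈ S, v i = w) ∧ (∀ i ∈ T, v i = -w) := by
  have hk := Nat.two_mul_div_two_add_one_of_odd hodd
  constructor
  · intro hsum
    obtain ⟨c, hcu⟩ := exists_complementary_functional hdim hu
    set σ := Tuple.sort fun i ↦ c (v i) / (|c (v i)| + u (v i))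
    have hmono := Tuple.monotone_sort fun i ↦ c (v i) / (|c (v i)| + u (v i))
    let j : Fin n := ⟨n / 2, by omega⟩
    have hj : j.rev = j := by
      ext
      simp only [Fin.val_rev, j]
      omega
    obtain ⟨hline, hzero⟩ := map_eq_zero_of_norm_sum_eq_one hcu (v := v ∘ σ) (fun i ↦ hv _)
      (fun i ↦ hpos _) hmono hj (by rw [← hsum]; exact congrArg _ (Equiv.sum_comp σ v))
    have hline' : ∀ i ≠ σ j, u (v i) = 0 := fun i hi ↦ by
      simpa using hline (σ.symm i) fun h ↦ hi (by rw [← h, Equiv.apply_symm_apply])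
    have hzero' : ∑ i ∈ Finset.univ.erase (σ j), v i = 0 := by
      have h₁ := Finset.add_sum_erase Finset.univ v (Finset.mem_univ (σ j))
      have h₂ := Finset.add_sum_erase Finset.univ (v ∘ σ) (Finset.mem_univ j)
      rw [hzero, add_zero, Function.comp_apply] at h₂
      have h₃ : ∑ i, (v ∘ σ) i = ∑ i, v i := Equiv.sum_comp σ v
      rw [← h₃, ← h₂] at h₁
      exact add_eq_left.1 h₁
    have : Nontrivial (Fin n) := Fin.nontrivial_iff_two_le.2 (by omega)
    obtain ⟨i₀, hi₀⟩ := exists_ne (σ j)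
    have hw : v i₀ ≠ 0 := norm_ne_zero_iff.1 (by simp [hv])
    classical
    let A := Finset.univ.erase (σ j)
    let S := A.filter fun i ↦ v i = v i₀
    let T := A.filter fun i ↦ ¬ v i = v i₀
    have hS : ∀ i ∈ S, v i = v i₀ := fun i hi ↦ (Finset.mem_filter.1 hi).2
    have hT : ∀ i ∈ T, v i = -v i₀ := fun i hi ↦ by
      obtain ⟨hiA, hne⟩ := Finset.mem_filter.1 hi
      exact (eq_or_eq_neg_of_map_eq_zero hdim hu (hv i₀) (hv i) (hline' _ hi₀)
        (hline' _ (Finset.ne_of_mem_erase hiA))).resolve_left hne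
    have hcard : S.card + T.card = n - 1 := by
      rw [Finset.card_filter_add_card_filter_not, Finset.card_erase_of_mem (Finset.mem_univ _),
        Finset.card_univ, Fintype.card_fin]
    have hbal : S.card = T.card := by
      have h := Finset.sum_filter_add_sum_filter_not A (fun i ↦ v i = v i₀) v
      rw [hzero', Finset.sum_congr rfl hS, Finset.sum_congr rfl hT, Finset.sum_const,
        Finset.sum_const, smul_neg, add_neg_eq_zero, ← Nat.cast_smul_eq_nsmul ℝ,
        ← Nat.cast_smul_eq_nsmul ℝ] at h
      exact_mod_cast smul_left_injective ℝ hw h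
    exact ⟨v i₀, S, T, hv i₀, Finset.disjoint_filter_filter_not _ _ _, by omega, by omega, hS, hT⟩
  · rintro ⟨w, S, T, -, hST, hScard, hTcard, hS, hT⟩
    classical
    have hcompl : (S ∪ T)ᶜ.card = 1 := by
      rw [Finset.card_compl, Finset.card_union_of_disjoint hST, Fintype.card_fin]
      omega
    obtain ⟨i, hi⟩ := Finset.card_eq_one.1 hcompl
    rw [← Finset.sum_add_sum_compl (S ∪ T), hi, Finset.sum_singleton, Finset.sum_union hST,
      Finset.sum_congr rfl hS, Finset.sum_congr rfl hT, Finset.sum_const, Finset.sum_const,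
      hScard, hTcard, smul_neg, add_neg_cancel, zero_add, hv]
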